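/- Let f : ℝⁿ → ℝ be smooth with |∇f|² = 1 everywhere and Δf = b for a constant b ∈ ℝ, let a ∈ ℝ, let u : ℝⁿ → ℝ be smooth with compact support, and set g₁ = cos(af), g₂ = sin(af), p_i = (Δ²g_i)·u + 2∇(Δg_i)·∇u + 2(Δg_i)(Δu) + 2Δ(∇g_i·∇u) + 2∇g_i·∇(Δu) for i = 1, 2. Then ∫ g₁·u·p₁ dv + ∫ g₂·u·p₂ dv = ∫ [ (a⁴ − a²b²)·u² + 4a²·(∇f·∇u)² − 2a²·u·Δu ] dv. -/

import Mathlib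

open MeasureTheory Real Filter
open scoped RealInnerProductSpace

/-- The partial derivative `∂f/∂x_m` on `ℝⁿ`. -/
noncomputable def pd {n : ℕ} (m : Fin n) (f : EuclideanSpace ℝ (Fin n) → ℝ)
    (x : EuclideanSpace ℝ (Fin n)) : ℝ :=
  fderiv ℝ f x (EuclideanSpace.single m 1)

/-- The Laplacian `Δf = ∑ ∂²f/∂x_m²` on `ℝⁿ`. -/
noncomputable def lap {n : ℕ} (f : EuclideanSpace ℝ (Fin n) → ℝ)
    (x : EuclideanSpace ℝ (Fin n)) : ℝ :=
  ∑ m : Fin n, pd m (pd m f) x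

/-- `p = (Δ²g)·u + 2∇(Δg)·∇u + 2(Δg)(Δu) + 2Δ(∇g·∇u) + 2∇g·∇(Δu)`. -/
noncomputable def pOf {n : ℕ} (g u : EuclideanSpace ℝ (Fin n) → ℝ)
    (x : EuclideanSpace ℝ (Fin n)) : ℝ :=
  lap (lap g) x * u x + 2 * ⟪gradient (lap g) x, gradient u x⟫
    + 2 * lap g x * lap u x
    + 2 * lap (fun y => ⟪gradient g y, gradient u y⟫) x
    + 2 * ⟪gradient g x, gradient (lap u) x⟫

section PartialDerivatives

variable {n : ℕ} {f g h k u : EuclideanSpace ℝ (Fin n) → ℝ}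

/-- The pointwise inner product `∇g·∇u` in coordinates. -/
noncomputable def gradDot (g u : EuclideanSpace ℝ (Fin n) → ℝ)
    (x : EuclideanSpace ℝ (Fin n)) : ℝ :=
  ∑ m : Fin n, pd m g x * pd m u x

lemma inner_gradient_eq_gradDot (g u : EuclideanSpace ℝ (Fin n) → ℝ)
    (x : EuclideanSpace ℝ (Fin n)) :
    ⟪gradient g x, gradient u x⟫ = gradDot g u x := by
  rw [← (EuclideanSpace.basisFun (Fin n) ℝ).sum_inner_mul_inner]
  refine Finset.sum_congr rfl fun m _ => ?_
  rw [real_inner_comm (gradient u x)]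
  simp only [gradient, InnerProductSpace.toDual_symm_apply, EuclideanSpace.basisFun_apply, pd]

lemma contDiff_pd (hg : ContDiff ℝ (⊤ : ℕ∞) g) (m : Fin n) :
    ContDiff ℝ (⊤ : ℕ∞) (pd m g) :=
  (hg.fderiv_right (m := (⊤ : ℕ∞)) (by simp)).clm_apply contDiff_const

lemma contDiff_lap (hg : ContDiff ℝ (⊤ : ℕ∞) g) : ContDiff ℝ (⊤ : ℕ∞) (lap g) :=
  ContDiff.sum fun m _ => contDiff_pd (contDiff_pd hg m) m

lemma contDiff_gradDot (hg : ContDiff ℝ (⊤ : ℕ∞) g) (hu : ContDiff ℝ (⊤ : ℕ∞) u) :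
    ContDiff ℝ (⊤ : ℕ∞) (gradDot g u) :=
  ContDiff.sum fun m _ => (contDiff_pd hg m).mul (contDiff_pd hu m)

lemma hasCompactSupport_pd (hg : HasCompactSupport g) (m : Fin n) :
    HasCompactSupport (pd m g) :=
  hg.fderiv_apply (𝕜 := ℝ) _

lemma pd_add (hg : Differentiable ℝ g) (hu : Differentiable ℝ u) (m : Fin n) :
    pd m (fun x => g x + u x) = fun x => pd m g x + pd m u x := by
  ext x
  simp only [pd]
  rw [fderiv_fun_add (hg x) (hu x)]
  rfl

lemma pd_mul (hg : Differentiable ℝ g) (hu : Differentiable ℝ u) (m : Fin n) :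
    pd m (fun x => g x * u x) = fun x => pd m g x * u x + g x * pd m u x := by
  ext x
  simp only [pd]
  rw [fderiv_fun_mul (hg x) (hu x)]
  simp only [add_apply, smul_apply, smul_eq_mul]
  ring

lemma ContDiff.differentiable_of_smooth (hg : ContDiff ℝ (⊤ : ℕ∞) g) : Differentiable ℝ g :=
  hg.differentiable (by simp)

lemma lap_add (hg : ContDiff ℝ (⊤ : ℕ∞) g) (hu : ContDiff ℝ (⊤ : ℕ∞) u) :
    lap (fun x => g x + u x) = fun x => lap g x + lap u x := by
  ext x
  simp only [lap, ← Finset.sum_add_distrib]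
  refine Finset.sum_congr rfl fun m _ => ?_
  rw [pd_add hg.differentiable_of_smooth hu.differentiable_of_smooth,
    pd_add (contDiff_pd hg m).differentiable_of_smooth (contDiff_pd hu m).differentiable_of_smooth]

lemma lap_mul (hg : ContDiff ℝ (⊤ : ℕ∞) g) (hu : ContDiff ℝ (⊤ : ℕ∞) u) :
    lap (fun x => g x * u x) =
      fun x => lap g x * u x + (gradDot g u x + gradDot g u x) + g x * lap u x := by
  ext x
  simp only [lap, gradDot, Finset.sum_mul, Finset.mul_sum, ← Finset.sum_add_distrib]
  refine Finset.sum_congr rfl fun m _ => ?_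
  have hg' := hg.differentiable_of_smooth
  have hu' := hu.differentiable_of_smooth
  have hgm := contDiff_pd hg m
  have hum := contDiff_pd hu m
  rw [pd_mul hg' hu', pd_add (hgm.mul hu).differentiable_of_smooth
      (hg.mul hum).differentiable_of_smooth,
    pd_mul hgm.differentiable_of_smooth hu', pd_mul hg' hum.differentiable_of_smooth]
  ring

/-- `p = Δ²(gu) - gΔ²u`. -/
lemma pOf_eq (hg : ContDiff ℝ (⊤ : ℕ∞) g) (hu : ContDiff ℝ (⊤ : ℕ∞) u)
    (x : EuclideanSpace ℝ (Fin n)) :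
    pOf g u x = lap (lap fun y => g y * u y) x - g x * lap (lap u) x := by
  have hd := contDiff_gradDot hg hu
  have hlg := contDiff_lap hg
  have hlu := contDiff_lap hu
  rw [lap_mul hg hu, lap_add ((hlg.mul hu).add (hd.add hd)) (hg.mul hlu),
    lap_add (hlg.mul hu) (hd.add hd), lap_add hd hd, lap_mul hlg hu, lap_mul hg hlu]
  simp only [pOf, inner_gradient_eq_gradDot]
  ring

/-- Green's first identity. -/
lemma integral_mul_lap (hh : ContDiff ℝ (⊤ : ℕ∞) h) (hhs : HasCompactSupport h)
    (hk : ContDiff ℝ (⊤ : ℕ∞) k) :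
    ∫ x, h x * lap k x = -∫ x, gradDot h k x := by
  have hi₁ : ∀ m : Fin n, Integrable fun x => h x * pd m (pd m k) x := fun m =>
    (hh.continuous.mul (contDiff_pd (contDiff_pd hk m) m).continuous).integrable_of_hasCompactSupport
      hhs.mul_right
  have hi₂ : ∀ m : Fin n, Integrable fun x => pd m h x * pd m k x := fun m =>
    ((contDiff_pd hh m).continuous.mul (contDiff_pd hk m).continuous).integrable_of_hasCompactSupport
      (hasCompactSupport_pd hhs m).mul_right
  simp only [lap, gradDot, Finset.mul_sum]
  rw [integral_finsetSum _ fun m _ => hi₁ m, integral_finsetSum _ fun m _ => hi₂ m,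
    ← Finset.sum_neg_distrib]
  refine Finset.sum_congr rfl fun m _ => ?_
  exact integral_mul_fderiv_eq_neg_fderiv_mul_of_integrable (hi₂ m) (hi₁ m)
    ((hh.continuous.mul (contDiff_pd hk m).continuous).integrable_of_hasCompactSupport
      hhs.mul_right) (fun x _ => hh.differentiable_of_smooth x)
    (fun x _ => (contDiff_pd hk m).differentiable_of_smooth x)

lemma gradDot_comm (g u : EuclideanSpace ℝ (Fin n) → ℝ) : gradDot g u = gradDot u g := by
  ext x
  simp only [gradDot, mul_comm]

lemma hasCompactSupport_lap (hg : HasCompactSupport g) : HasCompactSupport (lap g) := by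
  have hsub : tsupport (lap g) ⊆ tsupport g := by
    refine closure_minimal (fun x hx => ?_) (isClosed_tsupport g)
    by_contra hxg
    refine hx (Finset.sum_eq_zero fun m _ => ?_)
    have h0 : pd m g =ᶠ[nhds x] fun _ => 0 := by
      filter_upwards [(isClosed_tsupport g).isOpen_compl.mem_nhds hxg] with y hy
      simp [pd, fderiv_of_notMem_tsupport (𝕜 := ℝ) hy]
    simp [pd, h0.fderiv_eq]
  exact hg.of_isClosed_subset (isClosed_tsupport _) hsub

/-- `∫ hΔ²h = ∫ (Δh)²`. -/
lemma integral_mul_lap_lap (hh : ContDiff ℝ (⊤ : ℕ∞) h) (hhs : HasCompactSupport h) :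
    ∫ x, h x * lap (lap h) x = ∫ x, lap h x ^ 2 := by
  simp only [sq]
  rw [integral_mul_lap hh hhs (contDiff_lap hh), gradDot_comm,
    integral_mul_lap (contDiff_lap hh) (hasCompactSupport_lap hhs) hh]

lemma pd_cos_const_mul (hf : Differentiable ℝ f) (a : ℝ) (m : Fin n) :
    pd m (fun x => Real.cos (a * f x)) = fun x => -a * (Real.sin (a * f x) * pd m f x) := by
  ext x
  simp only [pd]
  rw [((hf x).hasFDerivAt.const_mul a).cos.fderiv]
  simp only [smul_apply, smul_eq_mul]
  ring

lemma pd_sin_const_mul (hf : Differentiable ℝ f) (a : ℝ) (m : Fin n) :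
    pd m (fun x => Real.sin (a * f x)) = fun x => a * (Real.cos (a * f x) * pd m f x) := by
  ext x
  simp only [pd]
  rw [((hf x).hasFDerivAt.const_mul a).sin.fderiv]
  simp only [smul_apply, smul_eq_mul]
  ring

lemma pd_const_mul (hg : Differentiable ℝ g) (c : ℝ) (m : Fin n) :
    pd m (fun x => c * g x) = fun x => c * pd m g x := by
  ext x
  simp only [pd]
  rw [fderiv_const_mul (hg x)]
  rfl

lemma contDiff_cos_const_mul (hf : ContDiff ℝ (⊤ : ℕ∞) f) (a : ℝ) :
    ContDiff ℝ (⊤ : ℕ∞) fun x => Real.cos (a * f x) :=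
  (contDiff_const.mul hf).cos

lemma contDiff_sin_const_mul (hf : ContDiff ℝ (⊤ : ℕ∞) f) (a : ℝ) :
    ContDiff ℝ (⊤ : ℕ∞) fun x => Real.sin (a * f x) :=
  (contDiff_const.mul hf).sin

lemma lap_cos_const_mul (hf : ContDiff ℝ (⊤ : ℕ∞) f) (a : ℝ) (x : EuclideanSpace ℝ (Fin n)) :
    lap (fun y => Real.cos (a * f y)) x =
      -a ^ 2 * Real.cos (a * f x) * gradDot f f x - a * Real.sin (a * f x) * lap f x := by
  simp only [lap, gradDot, Finset.mul_sum, ← Finset.sum_sub_distrib]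
  refine Finset.sum_congr rfl fun m _ => ?_
  have hf' := hf.differentiable_of_smooth
  have hs := contDiff_sin_const_mul hf a
  have hm := contDiff_pd hf m
  rw [pd_cos_const_mul hf', pd_const_mul (hs.mul hm).differentiable_of_smooth,
    pd_mul hs.differentiable_of_smooth hm.differentiable_of_smooth, pd_sin_const_mul hf']
  ring

lemma lap_sin_const_mul (hf : ContDiff ℝ (⊤ : ℕ∞) f) (a : ℝ) (x : EuclideanSpace ℝ (Fin n)) :
    lap (fun y => Real.sin (a * f y)) x =
      -a ^ 2 * Real.sin (a * f x) * gradDot f f x + a * Real.cos (a * f x) * lap f x := by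
  simp only [lap, gradDot, Finset.mul_sum, ← Finset.sum_add_distrib]
  refine Finset.sum_congr rfl fun m _ => ?_
  have hf' := hf.differentiable_of_smooth
  have hc := contDiff_cos_const_mul hf a
  have hm := contDiff_pd hf m
  rw [pd_sin_const_mul hf', pd_const_mul (hc.mul hm).differentiable_of_smooth,
    pd_mul hc.differentiable_of_smooth hm.differentiable_of_smooth, pd_cos_const_mul hf']
  ring

lemma gradDot_cos_const_mul (hf : Differentiable ℝ f) (a : ℝ) (x : EuclideanSpace ℝ (Fin n)) :
    gradDot (fun y => Real.cos (a * f y)) u x = -a * Real.sin (a * f x) * gradDot f u x := by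
  simp only [gradDot, pd_cos_const_mul hf, Finset.mul_sum, mul_assoc]

lemma gradDot_sin_const_mul (hf : Differentiable ℝ f) (a : ℝ) (x : EuclideanSpace ℝ (Fin n)) :
    gradDot (fun y => Real.sin (a * f y)) u x = a * Real.cos (a * f x) * gradDot f u x := by
  simp only [gradDot, pd_sin_const_mul hf, Finset.mul_sum, mul_assoc]

/-- `(Δ(cos(af)u))² + (Δ(sin(af)u))²` when `|∇f|² = 1`. -/
lemma lap_cos_mul_sq_add_lap_sin_mul_sq (hf : ContDiff ℝ (⊤ : ℕ∞) f)
    (hu : ContDiff ℝ (⊤ : ℕ∞) u) (a : ℝ) {x : EuclideanSpace ℝ (Fin n)}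
    (hgrad : gradDot f f x = 1) :
    lap (fun y => Real.cos (a * f y) * u y) x ^ 2 + lap (fun y => Real.sin (a * f y) * u y) x ^ 2 =
      (lap u x - a ^ 2 * u x) ^ 2 + a ^ 2 * (lap f x * u x + 2 * gradDot f u x) ^ 2 := by
  rw [lap_mul (contDiff_cos_const_mul hf a) hu, lap_mul (contDiff_sin_const_mul hf a) hu]
  simp only [lap_cos_const_mul hf, lap_sin_const_mul hf,
    gradDot_cos_const_mul hf.differentiable_of_smooth,
    gradDot_sin_const_mul hf.differentiable_of_smooth, hgrad]
  linear_combination ((lap u x - a ^ 2 * u x) ^ 2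
    + a ^ 2 * (lap f x * u x + 2 * gradDot f u x) ^ 2) * Real.sin_sq_add_cos_sq (a * f x)

/-- `∫ u²Δf = -2∫ u ∇f·∇u`. -/
lemma integral_sq_mul_lap (hf : ContDiff ℝ (⊤ : ℕ∞) f) (hu : ContDiff ℝ (⊤ : ℕ∞) u)
    (hus : HasCompactSupport u) :
    ∫ x, u x * u x * lap f x = -∫ x, 2 * (u x * gradDot f u x) := by
  rw [integral_mul_lap (hu.mul hu) hus.mul_right hf]
  congr 2 with x
  simp only [gradDot, pd_mul hu.differentiable_of_smooth hu.differentiable_of_smooth,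
    Finset.mul_sum]
  exact Finset.sum_congr rfl fun m _ => by ring

/-- `∫ gu(Δ²(gu) - gΔ²u)` after integrating by parts in the first term. -/
lemma integral_mul_mul_pOf (hg : ContDiff ℝ (⊤ : ℕ∞) g) (hu : ContDiff ℝ (⊤ : ℕ∞) u)
    (hus : HasCompactSupport u) :
    ∫ x, g x * u x * pOf g u x =
      (∫ x, lap (fun y => g y * u y) x ^ 2) - ∫ x, g x ^ 2 * (u x * lap (lap u) x) := by
  have hgu := hg.mul hu
  have hgus : HasCompactSupport fun x => g x * u x := hus.mul_left
  rw [← integral_mul_lap_lap hgu hgus, ← integral_sub]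
  · congr 1 with x
    rw [pOf_eq hg hu]
    ring
  · exact (hgu.continuous.mul
      (contDiff_lap (contDiff_lap hgu)).continuous).integrable_of_hasCompactSupport hgus.mul_right
  · exact ((hg.continuous.pow 2).mul (hu.continuous.mul
      (contDiff_lap (contDiff_lap hu)).continuous)).integrable_of_hasCompactSupport
      hus.mul_right.mul_left

end PartialDerivatives

/-- Proposition 2.2: `∫ g₁·u·p₁ + ∫ g₂·u·p₂ = ∫ [(a⁴ − a²b²)u² + 4a²(∇f·∇u)² − 2a²·u·Δu]`
with `g₁ = cos(af)`, `g₂ = sin(af)`, when `|∇f|² = 1` and `Δf = b`. -/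
theorem clamped_plate_gup_trig_integral {n : ℕ} (hn : 1 ≤ n)
    (f u : EuclideanSpace ℝ (Fin n) → ℝ)
    (hf : ContDiff ℝ (⊤ : ℕ∞) f) (hu : ContDiff ℝ (⊤ : ℕ∞) u)
    (hus : HasCompactSupport u)
    (a b : ℝ)
    (hgrad : ∀ x, ⟪gradient f x, gradient f x⟫ = 1)
    (hlap : ∀ x, lap f x = b) :
    (∫ x, Real.cos (a * f x) * u x * pOf (fun y => Real.cos (a * f y)) u x)
      + (∫ x, Real.sin (a * f x) * u x * pOf (fun y => Real.sin (a * f y)) u x) =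
    ∫ x, ((a ^ 4 - a ^ 2 * b ^ 2) * u x ^ 2
      + 4 * a ^ 2 * ⟪gradient f x, gradient u x⟫ ^ 2
      - 2 * a ^ 2 * u x * lap u x) := by
  have hgrad' : ∀ x, gradDot f f x = 1 := fun x => by
    rw [← inner_gradient_eq_gradDot, hgrad]
  have hc := contDiff_cos_const_mul hf a
  have hs := contDiff_sin_const_mul hf a
  have hlu := contDiff_lap hu
  have hllu := contDiff_lap hlu
  have hd := contDiff_gradDot hf hu
  have hlap_sq : ∀ g : EuclideanSpace ℝ (Fin n) → ℝ, ContDiff ℝ (⊤ : ℕ∞) g →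
      HasCompactSupport g → Integrable fun x => lap g x ^ 2 := fun g hg hgs => by
    simp only [sq]
    exact ((contDiff_lap hg).continuous.mul
      (contDiff_lap hg).continuous).integrable_of_hasCompactSupport
      (hasCompactSupport_lap hgs).mul_right
  have hmul : ∀ g : EuclideanSpace ℝ (Fin n) → ℝ, Continuous g →
      Integrable fun x => u x * g x := fun g hg =>
    (hu.continuous.mul hg).integrable_of_hasCompactSupport hus.mul_right
  have hparts : ∫ x, (u x * lap (lap u) x) =
      (∫ x, Real.cos (a * f x) ^ 2 * (u x * lap (lap u) x))
        + ∫ x, Real.sin (a * f x) ^ 2 * (u x * lap (lap u) x) := by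
    rw [← integral_add]
    · congr 1 with x
      linear_combination -(u x * lap (lap u) x) * Real.sin_sq_add_cos_sq (a * f x)
    · exact (hmul _ ((hc.continuous.pow 2).mul hllu.continuous)).congr
        (.of_forall fun x => by simp only [Pi.mul_apply, Pi.pow_apply]; ring)
    · exact (hmul _ ((hs.continuous.pow 2).mul hllu.continuous)).congr
        (.of_forall fun x => by simp only [Pi.mul_apply, Pi.pow_apply]; ring)
  have hI₁ := hlap_sq _ (hc.mul hu) hus.mul_left
  have hI₂ := hlap_sq _ (hs.mul hu) hus.mul_left
  have hI₃ := hlap_sq _ hu hus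
  have hI₁₂ : Integrable fun x => lap (fun y => Real.cos (a * f y) * u y) x ^ 2
      + lap (fun y => Real.sin (a * f y) * u y) x ^ 2 := hI₁.add hI₂
  have hJ₁ : Integrable fun x => u x * u x * lap f x :=
    (hmul _ (hu.continuous.mul (contDiff_lap hf).continuous)).congr
      (.of_forall fun x => by simp only [Pi.mul_apply]; ring)
  have hJ₂ : Integrable fun x => 2 * (u x * gradDot f u x) :=
    (hmul _ hd.continuous).const_mul 2
  have hzero : ∫ x, 2 * a ^ 2 * b * (u x * u x * lap f x + 2 * (u x * gradDot f u x)) = 0 := by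
    rw [integral_const_mul, integral_add hJ₁ hJ₂, integral_sq_mul_lap hf hu hus]
    ring
  have hsum : ∀ A B C D : ℝ, A - B + (C - D) = A + C - (B + D) := fun _ _ _ _ => by ring
  rw [integral_mul_mul_pOf hc hu hus, integral_mul_mul_pOf hs hu hus, hsum, ← hparts,
    integral_mul_lap_lap hu hus, ← integral_add hI₁ hI₂, ← integral_sub hI₁₂ hI₃]
  refine (sub_zero _).symm.trans ?_
  rw [← hzero]
  refine (integral_sub (hI₁₂.sub hI₃) ((hJ₁.add hJ₂).const_mul _)).symm.trans ?_
  congr 1 with x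
  simp only [Pi.sub_apply, Pi.add_apply]
  simp only [inner_gradient_eq_gradDot]
  rw [lap_cos_mul_sq_add_lap_sin_mul_sq hf hu a (hgrad' x), hlap]
  ring
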